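/- For every integer k ≥ 1, the number of set partitions of a 2k-element set in which every block has at least two elements equals ∑_{j=1}^{2k} (−1)^{j−1} B(2k−j) + 1. -/

import Mathlib

/-- `B r`: the Bell number, i.e. the number of set partitions of an
`r`-element set. -/
noncomputable def bellNumber (r : ℕ) : ℕ :=
  Nat.card (Finpartition (Finset.univ : Finset (Fin r)))

/-- `a r`: the number of set partitions of an `r`-element set in which every
block has at least two elements. -/
noncomputable def noSingletonPartitionCount (r : ℕ) : ℕ :=
  Nat.card {P : Finpartition (Finset.univ : Finset (Fin r)) //
    ∀ b ∈ P.parts, 2 ≤ b.card}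

/-- The finite partitions of a finite type correspond to its equivalence relations. -/
noncomputable def finpartitionUnivEquivSetoid (α : Type*) [Fintype α] [DecidableEq α] :
    Finpartition (Finset.univ : Finset α) ≃ Setoid α where
  toFun P := Setoid.ker P.part
  invFun r := by
    classical exact Finpartition.ofSetoid r
  left_inv P := by
    classical
    have hpart (x : α) : (Finpartition.ofSetoid (Setoid.ker P.part)).part x = P.part x := by
      ext y
      rw [Finpartition.mem_part_ofSetoid_iff_rel, Setoid.ker_def,
        P.mem_part_iff_part_eq_part (Finset.mem_univ _) (Finset.mem_univ _), eq_comm]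
    ext b
    constructor
    · intro hb
      obtain ⟨x, -, rfl⟩ := Finpartition.part_surjOn _ hb
      rw [hpart]
      simp
    · intro hb
      obtain ⟨x, -, rfl⟩ := P.part_surjOn hb
      rw [← hpart]
      simp
  right_inv r := by
    classical
    ext x y
    rw [Setoid.ker_def, ← Finpartition.mem_part_iff_part_eq_part _ (Finset.mem_univ _)
      (Finset.mem_univ _), Finpartition.mem_part_ofSetoid_iff_rel, Setoid.comm']

namespace Setoid

/-- An equivalence relation has no singleton class. -/
def NoSingletonClass {α : Type*} (r : Setoid α) : Prop :=
  ∀ x, ∃ y, y ≠ x ∧ r x y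

/-- Transport of equivalence relations without singleton classes along a bijection. -/
def noSingletonClassCongr {α β : Type*} (e : α ≃ β) :
    {r : Setoid α // r.NoSingletonClass} ≃ {r : Setoid β // r.NoSingletonClass} where
  toFun r := ⟨r.1.comap e.symm, fun x ↦ by
    obtain ⟨y, hne, hy⟩ := r.2 (e.symm x)
    exact ⟨e y, by simpa [← e.eq_symm_apply] using hne, by simpa [Setoid.comap_rel] using hy⟩⟩
  invFun r := ⟨r.1.comap e, fun x ↦ by
    obtain ⟨y, hne, hy⟩ := r.2 (e x)
    exact ⟨e.symm y, by simpa [e.symm_apply_eq] using hne, by simpa [Setoid.comap_rel] using hy⟩⟩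
  left_inv r := by ext x y; simp [Setoid.comap_rel]
  right_inv r := by ext x y; simp [Setoid.comap_rel]

/-- Adjoin a new point and merge it with all the singleton classes. -/
def mergeSingletons {α : Type*} (r : Setoid α) : Setoid (Option α) where
  r
    | none, none => True
    | none, some x => ∀ y, r x y → y = x
    | some x, none => ∀ y, r x y → y = x
    | some x, some y => r x y ∨ ((∀ z, r x z → z = x) ∧ ∀ z, r y z → z = y)
  iseqv := by
    have hs : ∀ {x y}, r x y → r y x := r.symm
    have ht : ∀ {x y z}, r x y → r y z → r x z := r.trans
    refine ⟨?_, ?_, ?_⟩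
    · rintro (_ | x)
      · trivial
      · exact Or.inl (r.refl x)
    · rintro (_ | x) (_ | y) <;> grind
    · rintro (_ | x) (_ | y) (_ | z) <;> grind

/-- Delete the point `none` and split the rest of its class into singletons. -/
def splitClassOfNone {α : Type*} (r : Setoid (Option α)) : Setoid α where
  r x y := x = y ∨ (r (some x) (some y) ∧ ¬ r (some x) none)
  iseqv := by
    have hs : ∀ {x y}, r x y → r y x := r.symm
    have ht : ∀ {x y z}, r x y → r y z → r x z := r.trans
    refine ⟨fun x ↦ Or.inl rfl, ?_, ?_⟩ <;> grind

/-- Equivalence relations with a singleton class correspond to equivalence relations without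
singleton classes on one more point. -/
def mergeSingletonsEquiv (α : Type*) :
    {r : Setoid α // ¬ r.NoSingletonClass} ≃
      {r : Setoid (Option α) // r.NoSingletonClass} where
  toFun r := ⟨r.1.mergeSingletons, by
    obtain ⟨r, hr⟩ := r
    simp only [NoSingletonClass, not_forall, not_exists, not_and'] at hr
    obtain ⟨x, hx⟩ := hr
    have hx' : ∀ y, r x y → y = x := fun y hy ↦ not_not.1 (hx y hy)
    rintro (_ | y)
    · exact ⟨some x, by simp, hx'⟩
    · by_cases hy : ∀ z, r y z → z = y
      · exact ⟨none, by simp, hy⟩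
      · push Not at hy
        obtain ⟨z, hz, hne⟩ := hy
        exact ⟨some z, by simpa using hne, Or.inl hz⟩⟩
  invFun r := ⟨r.1.splitClassOfNone, by
    obtain ⟨r, hr⟩ := r
    obtain ⟨_ | x, hne, hx⟩ := hr none
    · exact absurd rfl hne
    · intro h
      obtain ⟨y, hy, rfl | h⟩ := h x
      · exact hy rfl
      · exact h.2 (r.symm hx)⟩
  left_inv r := by
    obtain ⟨r, hr⟩ := r
    have hs : ∀ {x y}, r x y → r y x := r.symm
    have ht : ∀ {x y z}, r x y → r y z → r x z := r.trans
    have hrefl : ∀ x, r x x := r.refl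
    ext x y
    change (x = y ∨ ((r x y ∨ ((∀ z, r x z → z = x) ∧ ∀ z, r y z → z = y)) ∧
      ¬ ∀ z, r x z → z = x)) ↔ r x y
    grind
  right_inv r := by
    obtain ⟨r, hr⟩ := r
    have hs : ∀ {x y}, r x y → r y x := r.symm
    have ht : ∀ {x y z}, r x y → r y z → r x z := r.trans
    have hsingle (x : α) :
        (∀ y, r.splitClassOfNone x y → y = x) ↔ r (some x) none := by
      change (∀ y, (x = y ∨ (r (some x) (some y) ∧ ¬ r (some x) none)) → y = x) ↔ _
      constructor
      · intro h
        obtain ⟨_ | y, hne, hy⟩ := hr (some x)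
        · exact hy
        · grind
      · grind
    ext x y
    rcases x with _ | x <;> rcases y with _ | y
    · exact iff_of_true trivial (r.refl _)
    · exact (hsingle y).trans ⟨hs, hs⟩
    · exact hsingle x
    · change (r.splitClassOfNone x y ∨ _ ∧ _) ↔ _
      rw [hsingle, hsingle]
      change ((x = y ∨ _ ∧ _) ∨ _) ↔ _
      have hrefl : r (some x) (some x) := r.refl _
      grind

end Setoid

theorem bellNumber_eq_card_setoid (n : ℕ) : bellNumber n = Nat.card (Setoid (Fin n)) :=
  Nat.card_congr (finpartitionUnivEquivSetoid _)

theorem noSingletonPartitionCount_eq_card_setoid (n : ℕ) :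
    noSingletonPartitionCount n = Nat.card {r : Setoid (Fin n) // r.NoSingletonClass} := by
  refine Nat.card_congr ((finpartitionUnivEquivSetoid _).subtypeEquiv fun P ↦ ?_)
  have hrel (x y : Fin n) : finpartitionUnivEquivSetoid (Fin n) P x y ↔ y ∈ P.part x := by
    rw [P.mem_part_iff_part_eq_part (Finset.mem_univ _) (Finset.mem_univ _), eq_comm]
    rfl
  simp only [Setoid.NoSingletonClass, hrel]
  constructor
  · intro h x
    obtain ⟨y, hy, hne⟩ := Finset.exists_mem_ne (h (P.part x) (by simp)) x
    exact ⟨y, hne, hy⟩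
  · intro h b hb
    obtain ⟨x, -, rfl⟩ := P.part_surjOn hb
    obtain ⟨y, hne, hy⟩ := h x
    exact Finset.one_lt_card.2 ⟨y, hy, x, by simp, hne⟩

/-- Merging the singletons of a partition with a new point relates `B n` to `a n` and `a (n + 1)`. -/
theorem bellNumber_eq_add (n : ℕ) :
    bellNumber n = noSingletonPartitionCount n + noSingletonPartitionCount (n + 1) := by
  classical
  have : Finite (Setoid (Fin n)) := .of_equiv _ (finpartitionUnivEquivSetoid (Fin n))
  rw [bellNumber_eq_card_setoid, noSingletonPartitionCount_eq_card_setoid,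
    noSingletonPartitionCount_eq_card_setoid,
    Nat.card_congr (Setoid.noSingletonClassCongr (finSuccEquiv n)),
    ← Nat.card_congr (Setoid.mergeSingletonsEquiv (Fin n)), ← Nat.card_sum]
  exact Nat.card_congr (Equiv.sumCompl _).symm

theorem noSingletonPartitionCount_zero : noSingletonPartitionCount 0 = 1 := by
  rw [noSingletonPartitionCount_eq_card_setoid, Nat.card_eq_one_iff_exists]
  exact ⟨⟨⊥, fun x ↦ x.elim0⟩, fun r ↦ Subtype.ext (Setoid.ext fun x ↦ x.elim0)⟩

theorem noSingletonPartitionCount_eq_sum_bell_add (n : ℕ) :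
    (noSingletonPartitionCount n : ℤ) =
      (∑ j ∈ Finset.Icc 1 n, (-1 : ℤ) ^ (j - 1) * (bellNumber (n - j) : ℤ)) + (-1) ^ n := by
  have hIcc (m : ℕ) : ∑ j ∈ Finset.Icc 1 m, (-1 : ℤ) ^ (j - 1) * (bellNumber (m - j) : ℤ) =
      ∑ i ∈ Finset.range m, (-1 : ℤ) ^ i * (bellNumber (m - (i + 1)) : ℤ) := by
    rw [← Finset.Ico_add_one_right_eq_Icc, Finset.sum_Ico_eq_sum_range]
    simp [add_comm]
  rw [hIcc]
  induction n with
  | zero => simp [noSingletonPartitionCount_zero]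
  | succ n ih =>
    have h := bellNumber_eq_add n
    rw [Finset.sum_range_succ']
    simp only [pow_succ, Nat.add_sub_add_right, mul_neg, mul_one, neg_mul,
      Finset.sum_neg_distrib]
    simp only [pow_zero, one_mul]
    lia

/-- For every integer `k ≥ 1`, the number of set partitions of
a `2k`-element set in which every block has at least two elements equals
`∑_{j=1}^{2k} (−1)^{j−1} B(2k−j) + 1`. -/
theorem noSingletonPartitionCount_eq_alternating_sum_bell
    (k : ℕ) (hk : 1 ≤ k) :
    (noSingletonPartitionCount (2 * k) : ℤ) =
      (∑ j ∈ Finset.Icc 1 (2 * k), (-1 : ℤ) ^ (j - 1) * (bellNumber (2 * k - j) : ℤ)) + 1 := by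
  simpa using noSingletonPartitionCount_eq_sum_bell_add (2 * k)
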